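/- arXiv:2605.12403 — 9 statements merged into one kernel-verified Lean document; each statement's English description precedes it below -/
import Mathlib

section
/- Let X be a nonempty proper, locally connected, geodesic metric space. Assume that for every natural number n there exists a compact set K_n ⊆ X such that at least n distinct connected components of X \ K_n are unbounded. Then for every compact set K ⊆ X there exists a geodesic line γ : ℝ → X, i.e. a map with dist(γ s, γ t) = |s − t| for all s, t ∈ ℝ, such that γ t ∉ K for every t ∈ ℝ. -/
/-- A metric space is *geodesic* if any two points are joined by a unit-speed
minimizing geodesic segment. -/
def IsGeodesicSpace (X : Type*) [MetricSpace X] : Prop :=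
  ∀ x y : X, ∃ σ : ℝ → X, σ 0 = x ∧ σ (dist x y) = y ∧
    ∀ s ∈ Set.Icc (0 : ℝ) (dist x y), ∀ t ∈ Set.Icc (0 : ℝ) (dist x y),
      dist (σ s) (σ t) = |s - t|

/-- If a nonempty proper, locally connected, geodesic metric space has infinitely many
ends (for every `n` some compact set has at least `n` distinct unbounded complementary
components), then outside every compact set there is a geodesic line. -/
theorem escaping_geodesic_line (X : Type*) [MetricSpace X] [Nonempty X] [ProperSpace X]
    [LocallyConnectedSpace X] (hgeo : IsGeodesicSpace X)
    (hends : ∀ n : ℕ, ∃ K : Set X, IsCompact K ∧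
      ∃ f : Fin n → X, (∀ i, f i ∈ Kᶜ) ∧
        (∀ i, ¬ Bornology.IsBounded (connectedComponentIn Kᶜ (f i))) ∧
        Function.Injective (fun i => connectedComponentIn Kᶜ (f i))) :
    ∀ K : Set X, IsCompact K →
      ∃ γ : ℝ → X, (∀ s t : ℝ, dist (γ s) (γ t) = |s - t|) ∧ ∀ t : ℝ, γ t ∉ K := by
  intro K hK
  obtain ⟨p⟩ := ‹Nonempty X›
  obtain ⟨R0, hR0⟩ := hK.isBounded.subset_closedBall p
  obtain ⟨R, hR, hRpos⟩ : ∃ R : ℝ, K ⊆ Metric.closedBall p R ∧ 0 ≤ R :=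
    ⟨max R0 0, hR0.trans (Metric.closedBall_subset_closedBall (le_max_left _ _)), le_max_right _ _⟩
  obtain ⟨c, -, hcfin, hccov⟩ := (isCompact_closedBall p (R + 2)).finite_cover_balls
    (show (0 : ℝ) < 1 / 2 by norm_num)
  obtain ⟨L, hL, f, hfL, hfu, hfinj⟩ := hends (hcfin.toFinset.card + 1)
  obtain ⟨M0, hM0⟩ := hL.isBounded.subset_closedBall p
  obtain ⟨M, hM, hMpos⟩ : ∃ R : ℝ, L ⊆ Metric.closedBall p R ∧ 0 ≤ R :=
    ⟨max M0 0, hM0.trans (Metric.closedBall_subset_closedBall (le_max_left _ _)), le_max_right _ _⟩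
  have key : ∀ k : ℕ, ∃ σ : ℝ → X, dist (σ 0) p ≤ M ∧
      ∀ s ∈ Set.Icc (-(k : ℝ)) k, R + 1 ≤ dist (σ s) p ∧
        ∀ t ∈ Set.Icc (-(k : ℝ)) k, dist (σ s) (σ t) = |s - t| := by
    intro k
    have hx : ∀ i, ∃ x ∈ connectedComponentIn Lᶜ (f i), M + k + R + 2 < dist x p := by
      intro i
      by_contra! h
      exact hfu i ((Metric.isBounded_closedBall (x := p) (r := M + k + R + 2)).subset
        fun x hx => h x hx)
    choose x hxc hxd using hx
    have hkpos : (0 : ℝ) ≤ k := Nat.cast_nonneg k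
    have hy : ∀ i, ∃ y, dist y p = R + 2 ∧ dist y (x i) = dist (x i) p - (R + 2) := by
      intro i
      have hxi := hxd i
      obtain ⟨σ, h0, h1, h⟩ := hgeo p (x i)
      rw [dist_comm] at h1 h
      refine ⟨σ (R + 2), ?_, ?_⟩
      · rw [← h0, h _ ⟨by linarith, by linarith⟩ _ ⟨by linarith, by linarith⟩, sub_zero,
          abs_of_nonneg (by linarith)]
      · have := h (R + 2) ⟨by linarith, by linarith⟩ (dist (x i) p) ⟨by linarith, le_rfl⟩
        rw [h1] at this
        rw [this, abs_of_nonpos (by linarith)]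
        ring
    choose y hyp hyx using hy
    have hyc : ∀ i, ∃ z ∈ hcfin.toFinset, dist (y i) z < 1 / 2 := by
      intro i
      have := hccov (show y i ∈ Metric.closedBall p (R + 2) from (hyp i).le)
      simpa using this
    choose z hzc hyz using hyc
    obtain ⟨i, -, j, -, hij, hzz⟩ := Finset.exists_ne_map_eq_of_card_lt_of_maps_to
      (s := Finset.univ) (t := hcfin.toFinset) (f := z) (by simp) (fun i _ => hzc i)
    have hxx : dist (x i) (x j) < dist (x i) p + dist (x j) p - 2 * (R + 1) := by
      have h1 := dist_triangle4 (x i) (y i) (y j) (x j)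
      have h2 := dist_triangle_right (y i) (y j) (z i)
      have h3 := hyz i
      have h4 := hyz j
      rw [← hzz] at h4
      rw [dist_comm (x i) (y i), hyx, hyx] at h1
      linarith
    obtain ⟨σ, h0, h1, h⟩ := hgeo (x i) (x j)
    have hD : (0 : ℝ) ≤ dist (x i) (x j) := dist_nonneg
    have hi : ∀ s ∈ Set.Icc 0 (dist (x i) (x j)), dist (x i) (σ s) = s := by
      intro s hs
      have := h 0 ⟨le_rfl, hD⟩ s hs
      rwa [h0, zero_sub, abs_neg, abs_of_nonneg hs.1] at this
    have hj : ∀ s ∈ Set.Icc 0 (dist (x i) (x j)), dist (x j) (σ s) = dist (x i) (x j) - s := by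
      intro s hs
      have := h _ ⟨hD, le_rfl⟩ s hs
      rwa [h1, abs_of_nonneg (by linarith [hs.2])] at this
    have hmeet : ∃ a ∈ Set.Icc 0 (dist (x i) (x j)), σ a ∈ L := by
      by_contra! hno
      have hcont : ContinuousOn σ (Set.Icc 0 (dist (x i) (x j))) := by
        have : LipschitzOnWith 1 σ (Set.Icc 0 (dist (x i) (x j))) :=
          LipschitzOnWith.of_dist_le_mul fun s hs t ht => by
            rw [h s hs t ht, Real.dist_eq]; simp
        exact this.continuousOn
      have hpre := isPreconnected_Icc.image _ hcont
      have hxi : x i ∈ σ '' Set.Icc 0 (dist (x i) (x j)) := ⟨0, ⟨le_rfl, hD⟩, h0⟩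
      have hxj : x j ∈ σ '' Set.Icc 0 (dist (x i) (x j)) := ⟨_, ⟨hD, le_rfl⟩, h1⟩
      have hsub : σ '' Set.Icc 0 (dist (x i) (x j)) ⊆ Lᶜ := by
        rintro _ ⟨s, hs, rfl⟩
        exact hno s hs
      have h5 := hpre.subset_connectedComponentIn hxi hsub hxj
      apply hij
      apply hfinj
      change connectedComponentIn Lᶜ (f i) = connectedComponentIn Lᶜ (f j)
      rw [connectedComponentIn_eq (hxc i), connectedComponentIn_eq (hxc j),
        connectedComponentIn_eq h5]
    obtain ⟨a, ha, haL⟩ := hmeet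
    have haM : dist (σ a) p ≤ M := hM haL
    have hak : k ≤ a := by
      have := dist_triangle (x i) (σ a) p
      rw [hi a ha] at this
      linarith [hxd i]
    have hak' : a + k ≤ dist (x i) (x j) := by
      have := dist_triangle (x j) (σ a) p
      rw [hj a ha] at this
      linarith [hxd j]
    refine ⟨fun t => σ (a + t), by simpa using haM, fun s hs => ?_⟩
    have hs' : a + s ∈ Set.Icc 0 (dist (x i) (x j)) :=
      ⟨by linarith [hs.1], by linarith [hs.2]⟩
    refine ⟨?_, fun t ht => ?_⟩
    · have e1 := dist_triangle (x i) (σ (a + s)) p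
      have e2 := dist_triangle (x j) (σ (a + s)) p
      rw [hi _ hs'] at e1
      rw [hj _ hs'] at e2
      change R + 1 ≤ dist (σ (a + s)) p
      linarith
    · change dist (σ (a + s)) (σ (a + t)) = _
      rw [h _ hs' _ ⟨by linarith [ht.1], by linarith [ht.2]⟩]
      congr 1
      ring
  choose σ hσ0 hσ using key
  let U : Ultrafilter ℕ := Filter.hyperfilter ℕ
  have hU : (U : Filter ℕ) ≤ Filter.atTop := Nat.hyperfilter_le_atTop
  have hev : ∀ t : ℝ, ∀ᶠ k : ℕ in (U : Filter ℕ), t ∈ Set.Icc (-(k : ℝ)) k := by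
    intro t
    apply hU
    filter_upwards [Filter.eventually_ge_atTop ⌈|t|⌉₊] with k hk
    exact abs_le.1 (Nat.ceil_le.1 hk)
  have hlim : ∀ t : ℝ, ∃ q, Filter.Tendsto (fun k => σ k t) (U : Filter ℕ) (nhds q) := by
    intro t
    obtain ⟨q, -, hq⟩ := (isCompact_closedBall p (M + |t|)).ultrafilter_le_nhds
      (U.map (fun k => σ k t)) (by
        rw [Filter.le_principal_iff]
        change ∀ᶠ k in (U : Filter ℕ), σ k t ∈ Metric.closedBall p (M + |t|)
        filter_upwards [hev t, hev 0] with k hk hk0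
        have h1 := (hσ k t hk).2 0 hk0
        have h2 := dist_triangle (σ k t) (σ k 0) p
        rw [h1, sub_zero] at h2
        rw [Metric.mem_closedBall]
        linarith [hσ0 k])
    exact ⟨q, hq⟩
  choose γ hγ using hlim
  refine ⟨γ, fun s t => ?_, fun t htK => ?_⟩
  · refine tendsto_nhds_unique ((hγ s).dist (hγ t)) (tendsto_const_nhds.congr' ?_)
    filter_upwards [hev s, hev t] with k hs ht
    exact ((hσ k s hs).2 t ht).symm
  · have h1 : R + 1 ≤ dist (γ t) p := by
      refine ge_of_tendsto ((hγ t).dist tendsto_const_nhds) ?_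
      filter_upwards [hev t] with k hk
      exact (hσ k t hk).1
    have h2 : dist (γ t) p ≤ R := hR htK
    linarith
end

section
/- Let X be a nonempty proper, locally connected, geodesic metric space, let K ⊆ X be a nonempty compact set, and let V⁻ and V⁺ be two distinct connected components of X \ K, each of which is unbounded. Then there exist a geodesic line γ : ℝ → X, i.e. a map with dist(γ s, γ t) = |s − t| for all s, t ∈ ℝ, and a constant T ≥ 0 such that γ t ∈ V⁻ for all t ≤ −T and γ t ∈ V⁺ for all t ≥ T. -/
theorem aux_comp {X : Type*} [TopologicalSpace X] {F V S : Set X} 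
    (hV : ∃ x ∈ F, V = connectedComponentIn F x) (hS : IsPreconnected S) (hSF : S ⊆ F)
    {u v : X} (hu : u ∈ S) (hv : v ∈ S) (huV : u ∈ V) : v ∈ V := by
  obtain ⟨x, hx, rfl⟩ := hV
  rw [connectedComponentIn_eq huV]
  exact hS.subset_connectedComponentIn hu hSF hv

theorem aux_cont {X : Type*} [MetricSpace X] {g : ℝ → X} {S : Set ℝ}
    (h : ∀ s ∈ S, ∀ t ∈ S, dist (g s) (g t) = |s - t|) : ContinuousOn g S := by
  have : LipschitzOnWith 1 g S := LipschitzOnWith.of_dist_le_mul (fun s hs t ht => by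
    rw [h s hs t ht, Real.dist_eq]; simp)
  exact this.continuousOn

theorem aux_seg {X : Type*} [MetricSpace X] (hgeo : IsGeodesicSpace X)
    (K : Set X) (hK : IsCompact K) (hKne : K.Nonempty)
    (Vm Vp : Set X)
    (hVm : ∃ x ∈ Kᶜ, Vm = connectedComponentIn Kᶜ x)
    (hVp : ∃ x ∈ Kᶜ, Vp = connectedComponentIn Kᶜ x)
    (hne : Vm ≠ Vp)
    (hVmUnb : ¬ Bornology.IsBounded Vm) (hVpUnb : ¬ Bornology.IsBounded Vp) (N : ℕ) :
    ∃ (g : ℝ → X) (a b : ℝ), (N : ℝ) ≤ a ∧ (N : ℝ) ≤ b ∧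
      (∀ s ∈ Set.Icc (-a) b, ∀ t ∈ Set.Icc (-a) b, dist (g s) (g t) = |s - t|) ∧
      g 0 ∈ K ∧ g (-a) ∈ Vm ∧ g b ∈ Vp := by
  obtain ⟨p, hp⟩ := hKne
  obtain ⟨R, hR⟩ := hK.isBounded.subset_closedBall p
  have far : ∀ V : Set X, ¬ Bornology.IsBounded V → ∃ x ∈ V, (N : ℝ) + R < dist x p := by
    intro V hV
    by_contra! hc
    exact hV (Metric.isBounded_closedBall.subset (fun x hx => Metric.mem_closedBall.2 (hc x hx)))
  obtain ⟨x, hx, hxf⟩ := far Vm hVmUnb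
  obtain ⟨y, hy, hyf⟩ := far Vp hVpUnb
  obtain ⟨σ, h0, h1, hσ⟩ := hgeo x y
  have hd : (0 : ℝ) ≤ dist x y := dist_nonneg
  have m0 : (0 : ℝ) ∈ Set.Icc 0 (dist x y) := ⟨le_rfl, hd⟩
  have m1 : dist x y ∈ Set.Icc 0 (dist x y) := ⟨hd, le_rfl⟩
  have hit : ∃ c ∈ Set.Icc 0 (dist x y), σ c ∈ K := by
    by_contra! hc
    have hyV : y ∈ Vm := by
      refine aux_comp hVm (isPreconnected_Icc.image σ (aux_cont hσ)) ?_
        ⟨0, m0, h0⟩ ⟨_, m1, h1⟩ hx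
      rintro _ ⟨c, hcm, rfl⟩
      exact hc c hcm
    obtain ⟨u, hu, rfl⟩ := hVm
    obtain ⟨v, hv, rfl⟩ := hVp
    exact hne ((connectedComponentIn_eq hyV).trans (connectedComponentIn_eq hy).symm)
  obtain ⟨c, hcm, hcK⟩ := hit
  have hcR := Metric.mem_closedBall.1 (hR hcK)
  have e0 : dist x (σ c) = c := by
    rw [← h0, hσ 0 m0 c hcm, zero_sub, abs_neg, abs_of_nonneg hcm.1]
  have e1 : dist y (σ c) = dist x y - c := by
    conv_lhs => rw [← h1]
    rw [hσ _ m1 c hcm, abs_of_nonneg (by linarith [hcm.2])]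
  have t0 := dist_triangle x (σ c) p
  have t1 := dist_triangle y (σ c) p
  refine ⟨fun t => σ (t + c), c, dist x y - c, by linarith, by linarith, ?_, by simpa using hcK,
    by simpa [h0] using hx, by simpa [h1] using hy⟩
  intro s hs t ht
  have := hσ (s + c) ⟨by linarith [hs.1], by linarith [hs.2]⟩
    (t + c) ⟨by linarith [ht.1], by linarith [ht.2]⟩
  simpa using this

theorem aux_lim {X : Type*} [TopologicalSpace X] [LocallyConnectedSpace X] {F V : Set X}
    (hF : IsOpen F) (hV : ∃ x ∈ F, V = connectedComponentIn F x) {l : Filter ℕ} [l.NeBot]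
    {f : ℕ → X} {z : X} (hz : z ∈ F) (hf : Filter.Tendsto f l (nhds z))
    (hfV : ∀ᶠ n in l, f n ∈ V) : z ∈ V := by
  obtain ⟨n, h1, h2⟩ := ((hf.eventually
    (hF.connectedComponentIn.mem_nhds (mem_connectedComponentIn hz))).and hfV).exists
  exact aux_comp hV isPreconnected_connectedComponentIn (connectedComponentIn_subset F z)
    h1 (mem_connectedComponentIn hz) h2

/-- If `V⁻` and `V⁺` are two distinct unbounded connected components of the complement
of a nonempty compact set `K` in a nonempty proper, locally connected, geodesic metric
space, then there is a geodesic line going from `V⁻` to `V⁺`. -/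
theorem geodesic_line_between_ends (X : Type*) [MetricSpace X] [Nonempty X] [ProperSpace X]
    [LocallyConnectedSpace X] (hgeo : IsGeodesicSpace X)
    (K : Set X) (hK : IsCompact K) (hKne : K.Nonempty)
    (Vm Vp : Set X)
    (hVm : ∃ x ∈ Kᶜ, Vm = connectedComponentIn Kᶜ x)
    (hVp : ∃ x ∈ Kᶜ, Vp = connectedComponentIn Kᶜ x)
    (hne : Vm ≠ Vp)
    (hVmUnb : ¬ Bornology.IsBounded Vm) (hVpUnb : ¬ Bornology.IsBounded Vp) :
    ∃ (γ : ℝ → X) (T : ℝ), 0 ≤ T ∧ (∀ s t : ℝ, dist (γ s) (γ t) = |s - t|) ∧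
      (∀ t : ℝ, t ≤ -T → γ t ∈ Vm) ∧ (∀ t : ℝ, T ≤ t → γ t ∈ Vp) := by
  obtain ⟨p, hp⟩ := id hKne
  obtain ⟨R, hR⟩ := hK.isBounded.subset_closedBall p
  have hR0 : 0 ≤ R := by simpa using hR hp
  have hKd : ∀ u ∈ K, ∀ v ∈ K, dist u v ≤ 2 * R := by
    intro u hu v hv
    have h1 := Metric.mem_closedBall.1 (hR hu)
    have h2 := Metric.mem_closedBall.1 (hR hv)
    linarith [dist_triangle_right u v p]
  choose g a b ha hb hg hg0 hga hgb using
    aux_seg hgeo K hK hKne Vm Vp hVm hVp hne hVmUnb hVpUnb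
  let l : Ultrafilter ℕ := Filter.hyperfilter ℕ
  have hl : ∀ r : ℝ, ∀ᶠ n : ℕ in (l : Filter ℕ), r ≤ (n : ℝ) := fun r =>
    (Nat.hyperfilter_le_atTop : (l : Filter ℕ) ≤ Filter.atTop)
      ((tendsto_natCast_atTop_atTop (R := ℝ)).eventually_ge_atTop r)
  have hmem : ∀ t : ℝ, ∀ᶠ n in (l : Filter ℕ), t ∈ Set.Icc (-a n) (b n) := by
    intro t
    filter_upwards [hl |t|] with n hn
    have := abs_le.1 (hn.trans (ha n))
    have := abs_le.1 (hn.trans (hb n))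
    exact ⟨by linarith, by linarith⟩
  have z0 : ∀ n, (0 : ℝ) ∈ Set.Icc (-a n) (b n) := fun n => by
    have := ha n
    have := hb n
    have : (0 : ℝ) ≤ n := n.cast_nonneg
    exact ⟨by linarith, by linarith⟩
  have hlim : ∀ t : ℝ, ∃ z, Filter.Tendsto (fun n => g n t) l (nhds z) := by
    intro t
    obtain ⟨z, -, hz⟩ := (isCompact_closedBall p (|t| + R)).ultrafilter_le_nhds'
      (l.map (fun n => g n t)) (by
        change ∀ᶠ n in (l : Filter ℕ), g n t ∈ Metric.closedBall p (|t| + R)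
        filter_upwards [hmem t] with n hn
        have h1 := hg n t hn 0 (z0 n)
        have h2 := Metric.mem_closedBall.1 (hR (hg0 n))
        rw [sub_zero] at h1
        rw [Metric.mem_closedBall]
        linarith [dist_triangle (g n t) (g n 0) p])
    exact ⟨z, hz⟩
  choose γ hγ using hlim
  have hiso : ∀ s t : ℝ, dist (γ s) (γ t) = |s - t| := by
    intro s t
    refine tendsto_nhds_unique ((hγ s).dist (hγ t)) (tendsto_const_nhds.congr' ?_)
    filter_upwards [hmem s, hmem t] with n h1 h2
    exact (hg n s h1 t h2).symm
  have hγ0 : γ 0 ∈ K := hK.isClosed.mem_of_tendsto (hγ 0) (Filter.Eventually.of_forall hg0)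
  have hout : ∀ t : ℝ, 2 * R < |t| → γ t ∈ Kᶜ := by
    intro t ht hc
    have := hKd _ hc _ hγ0
    rw [hiso, sub_zero] at this
    linarith
  have houtn : ∀ n, ∀ t ∈ Set.Icc (-a n) (b n), 2 * R < |t| → g n t ∈ Kᶜ := by
    intro n t htm ht hc
    have := hKd _ hc _ (hg0 n)
    rw [hg n t htm 0 (z0 n), sub_zero] at this
    linarith
  refine ⟨γ, 2 * R + 1, by linarith, hiso, ?_, ?_⟩
  · intro t ht
    refine aux_lim hK.isClosed.isOpen_compl hVm (hout t ?_) (hγ t) ?_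
    · linarith [neg_le_abs t]
    · filter_upwards [hmem t] with n hn
      have hsub : Set.Icc (-a n) t ⊆ Set.Icc (-a n) (b n) := Set.Icc_subset_Icc_right hn.2
      refine aux_comp hVm (isPreconnected_Icc.image (g n) ((aux_cont (hg n)).mono hsub)) ?_
        ⟨-a n, ⟨le_rfl, hn.1⟩, rfl⟩ ⟨t, ⟨hn.1, le_rfl⟩, rfl⟩ (hga n)
      rintro _ ⟨c, hc, rfl⟩
      exact houtn n c (hsub hc) (by linarith [neg_le_abs c, hc.2])
  · intro t ht
    refine aux_lim hK.isClosed.isOpen_compl hVp (hout t ?_) (hγ t) ?_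
    · linarith [le_abs_self t]
    · filter_upwards [hmem t] with n hn
      have hsub : Set.Icc t (b n) ⊆ Set.Icc (-a n) (b n) := Set.Icc_subset_Icc_left hn.1
      refine aux_comp hVp (isPreconnected_Icc.image (g n) ((aux_cont (hg n)).mono hsub)) ?_
        ⟨b n, ⟨hn.2, le_rfl⟩, rfl⟩ ⟨t, ⟨le_rfl, hn.2⟩, rfl⟩ (hgb n)
      rintro _ ⟨c, hc, rfl⟩
      exact houtn n c (hsub hc) (by linarith [le_abs_self c, hc.1])
end

section
/- Let X be a proper metric space and K ⊆ X a nonempty compact set. For each l ∈ ℕ let a_l, b_l ≥ 0 with a_l → ∞ and b_l → ∞, and let γ_l : ℝ → X satisfy γ_l 0 ∈ K and dist(γ_l s, γ_l t) = |s − t| for all s, t ∈ [−a_l, b_l]. Then there exist a strictly increasing map φ : ℕ → ℕ and a map γ : ℝ → X with γ 0 ∈ K and dist(γ s, γ t) = |s − t| for all s, t ∈ ℝ, such that for every t ∈ ℝ, γ_{φ(k)}(t) → γ(t) as k → ∞. -/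
open Filter

/-- Longer and longer minimizing geodesic segments through a fixed compact set
subconverge pointwise to a geodesic line. -/
theorem geodesic_segments_subconverge_to_line (X : Type*) [MetricSpace X] [ProperSpace X]
    (K : Set X) (hK : IsCompact K) (hKne : K.Nonempty)
    (a b : ℕ → ℝ) (ha0 : ∀ l, 0 ≤ a l) (hb0 : ∀ l, 0 ≤ b l)
    (ha : Tendsto a atTop atTop) (hb : Tendsto b atTop atTop)
    (γ : ℕ → ℝ → X) (hγ0 : ∀ l, γ l 0 ∈ K)
    (hγ : ∀ l, ∀ s ∈ Set.Icc (-(a l)) (b l), ∀ t ∈ Set.Icc (-(a l)) (b l),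
      dist (γ l s) (γ l t) = |s - t|) :
    ∃ (φ : ℕ → ℕ) (γ' : ℝ → X), StrictMono φ ∧ γ' 0 ∈ K ∧
      (∀ s t : ℝ, dist (γ' s) (γ' t) = |s - t|) ∧
      ∀ t : ℝ, Tendsto (fun k => γ (φ k) t) atTop (nhds (γ' t)) := by
  classical
  obtain ⟨x0, hx0⟩ := hKne
  obtain ⟨R, hR⟩ := hK.isBounded.subset_closedBall x0
  have hev : ∀ t : ℝ, ∀ᶠ l in atTop, t ∈ Set.Icc (-(a l)) (b l) := by
    intro t
    filter_upwards [ha.eventually_ge_atTop (-t), hb.eventually_ge_atTop t] with l h1 h2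
    exact ⟨by linarith, h2⟩
  let v : ℕ → ℚ → X := fun l q => if (q : ℝ) ∈ Set.Icc (-(a l)) (b l) then γ l q else γ l 0
  have hv : ∀ l, v l ∈ Set.pi Set.univ (fun q : ℚ => Metric.closedBall x0 (R + |(q : ℝ)|)) := by
    intro l q _
    have h0 : dist (γ l 0) x0 ≤ R := hR (hγ0 l)
    have hq := abs_nonneg (q : ℝ)
    simp only [Metric.mem_closedBall, v]
    split_ifs with h
    · have h1 := hγ l q h 0 ⟨by linarith [ha0 l], hb0 l⟩
      rw [sub_zero] at h1
      linarith [dist_triangle (γ l q) (γ l 0) x0]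
    · linarith
  obtain ⟨w, -, φ, hφ, hw⟩ :=
    (isCompact_univ_pi (fun q : ℚ => isCompact_closedBall x0 (R + |(q : ℝ)|))).tendsto_subseq hv
  have hev' : ∀ t : ℝ, ∀ᶠ k in atTop, t ∈ Set.Icc (-(a (φ k))) (b (φ k)) :=
    fun t => hφ.tendsto_atTop.eventually (hev t)
  have hq : ∀ q : ℚ, Tendsto (fun k => γ (φ k) q) atTop (nhds (w q)) := by
    intro q
    refine (tendsto_pi_nhds.1 hw q).congr' ?_
    filter_upwards [hev' q] with k hk
    simp only [Function.comp, v]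
    rw [if_pos hk]
  have hlim : ∀ t : ℝ, ∃ x, Tendsto (fun k => γ (φ k) t) atTop (nhds x) := by
    intro t
    apply cauchySeq_tendsto_of_complete
    rw [Metric.cauchySeq_iff']
    intro ε hε
    obtain ⟨q, hq1, hq2⟩ := exists_rat_btwn (show t < t + ε / 4 by linarith)
    obtain ⟨N, hN⟩ := Metric.cauchySeq_iff'.1 (hq q).cauchySeq (ε / 4) (by linarith)
    obtain ⟨M, hM⟩ := eventually_atTop.1 ((hev' t).and (hev' q))
    have key : ∀ n ≥ M, dist (γ (φ n) t) (γ (φ n) q) < ε / 4 := by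
      intro n hn
      rw [hγ _ t (hM n hn).1 q (hM n hn).2, abs_lt]
      constructor <;> linarith
    refine ⟨max N M, fun n hn => ?_⟩
    have h1 := key n (le_trans (le_max_right _ _) hn)
    have h2 := key (max N M) (le_max_right _ _)
    have h3 := hN n (le_trans (le_max_left _ _) hn)
    have h4 := hN (max N M) (le_max_left _ _)
    have h5 := dist_triangle4 (γ (φ n) t) (γ (φ n) q) (γ (φ (max N M)) q) (γ (φ (max N M)) t)
    have h6 := dist_triangle_right (γ (φ n) q) (γ (φ (max N M)) q) (γ (φ N) q)
    rw [dist_comm (γ (φ (max N M)) q) (γ (φ (max N M)) t)] at h5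
    linarith
  choose γ' hγ' using hlim
  refine ⟨φ, γ', hφ, hK.isClosed.mem_of_tendsto (hγ' 0) (Eventually.of_forall fun k => hγ0 _),
    fun s t => ?_, hγ'⟩
  refine tendsto_nhds_unique ((hγ' s).dist (hγ' t)) (tendsto_const_nhds.congr' ?_)
  filter_upwards [hev' s, hev' t] with k hs ht
  exact (hγ _ s hs t ht).symm
end

section
/- Let X be a metric space, E ⊆ X a subset, p ∈ X, and q ∈ E with dist(p, q) = infDist(p, E). Let z ∈ X satisfy dist(p, z) + dist(z, q) = dist(p, q). Then infDist(z, E) = dist(z, q). Moreover, if q is the only point q' ∈ E with dist(p, q') = infDist(p, E), then q is also the only point q' ∈ E with dist(z, q') = infDist(z, E). -/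
/-- Every point on a minimizing geodesic from the unique foot point `q` to `p` has `q`
as its (unique) nearest point in `E`, with distance to `E` equal to its distance to `q`. -/
theorem nearest_point_along_segment (X : Type*) [MetricSpace X]
    (E : Set X) (p : X) (q : X) (hq : q ∈ E)
    (hnear : dist p q = Metric.infDist p E)
    (z : X) (hz : dist p z + dist z q = dist p q) :
    Metric.infDist z E = dist z q ∧
      ((∀ q' ∈ E, dist p q' = Metric.infDist p E → q' = q) →
        ∀ q' ∈ E, dist z q' = Metric.infDist z E → q' = q) := by
  have h1 : Metric.infDist z E = dist z q := by
    apply le_antisymm (Metric.infDist_le_dist_of_mem hq)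
    have h := Metric.infDist_le_infDist_add_dist (s := E) (x := p) (y := z)
    linarith
  refine ⟨h1, fun hu q' hq' he => hu q' hq' ?_⟩
  apply le_antisymm _ (Metric.infDist_le_dist_of_mem hq')
  have h := dist_triangle p z q'
  linarith
end

section
/- Let n ≥ 1 and let E be a nonempty closed subset of EuclideanSpace ℝ (Fin n). Let r > 0 and assume that every point p with 0 < infDist(p, E) < r has exactly one nearest point in E, i.e. exactly one q ∈ E with dist(p, q) = infDist(p, E). Suppose q ∈ E, v ∈ EuclideanSpace ℝ (Fin n) with ‖v‖ = 1, and there exists t* ∈ (0, r) with infDist(q + t*·v, E) = t*. Then for every t ∈ (0, r) one has infDist(q + t·v, E) = t, and q is the unique point of E with dist(q + t·v, q) = infDist(q + t·v, E). -/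
open Metric in
lemma npe_ascent {n : ℕ} (E : Set (EuclideanSpace ℝ (Fin n)))
    (hE : IsClosed E) (hEne : E.Nonempty) (x : EuclideanSpace ℝ (Fin n))
    (hx : 0 < infDist x E)
    (hu : ∃! q : EuclideanSpace ℝ (Fin n), q ∈ E ∧ dist x q = infDist x E)
    (c : ℝ) (hc : c < 1) :
    ∃ u : EuclideanSpace ℝ (Fin n), ‖u‖ = 1 ∧ ∀ δ > 0, ∃ h, 0 < h ∧ h < δ ∧
      infDist x E + c * h < infDist (x + h • u) E := by
  obtain ⟨y, ⟨hyE, hy⟩, hyu⟩ := hu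
  set d := infDist x E with hd
  have hny : ‖x - y‖ = d := by rw [← dist_eq_norm, hy]
  set u := d⁻¹ • (x - y) with hudef
  have hun : ‖u‖ = 1 := by
    rw [hudef, norm_smul, hny, Real.norm_of_nonneg (by positivity)]
    field_simp
  refine ⟨u, hun, ?_⟩
  have hinn : inner ℝ u (x - y) = d := by
    rw [hudef, real_inner_smul_left, real_inner_self_eq_norm_sq, hny]
    field_simp
  -- the bad set
  set K : Set (EuclideanSpace ℝ (Fin n)) := E ∩ {z | inner ℝ u (x - z) ≤ c * ‖x - z‖} with hK
  have hKc : IsClosed K :=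
    hE.inter (isClosed_le (by fun_prop) (by fun_prop))
  obtain ⟨m, hm, hmK⟩ : ∃ m, d < m ∧ ∀ z ∈ K, m ≤ dist x z := by
    rcases K.eq_empty_or_nonempty with h0 | h0
    · exact ⟨d + 1, by linarith, by simp [h0]⟩
    · obtain ⟨z, hz, hzd⟩ := hKc.exists_infDist_eq_dist h0 x
      refine ⟨dist x z, ?_, fun w hw => hzd ▸ infDist_le_dist_of_mem hw⟩
      refine lt_of_le_of_ne (infDist_le_dist_of_mem hz.1) fun he => ?_
      have := hyu z ⟨hz.1, he.symm⟩
      have h2 := hz.2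
      simp only [Set.mem_setOf_eq] at h2
      rw [this, hinn, hny] at h2
      nlinarith
  intro δ hδ
  obtain ⟨h, hh0, hh⟩ := exists_between (show 0 < min δ ((m - d) / 2) from
    lt_min hδ (by linarith))
  have hh1 := hh.trans_le (min_le_left _ _)
  have hh2 := hh.trans_le (min_le_right _ _)
  refine ⟨h, hh0, hh1, ?_⟩
  obtain ⟨z, hz, hzd⟩ := hE.exists_infDist_eq_dist hEne (x + h • u)
  have hxx : dist (x + h • u) x = h := by
    simp [dist_eq_norm, norm_smul, hun, abs_of_pos hh0]
  have h3 : infDist (x + h • u) E ≤ d + h := by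
    have := infDist_le_infDist_add_dist (s := E) (x := x + h • u) (y := x)
    rwa [hxx] at this
  have h4 : dist x z ≤ h + dist (x + h • u) z := by
    have := dist_triangle_left x z (x + h • u)
    rwa [hxx] at this
  have h5 : z ∉ K := fun hzK => by
    have := hmK z hzK
    linarith
  have h6 : c * ‖x - z‖ < inner ℝ u (x - z) := by
    by_contra hcon
    exact h5 ⟨hz, not_lt.1 hcon⟩
  have h7 : d ≤ ‖x - z‖ := by
    rw [← dist_eq_norm]; exact infDist_le_dist_of_mem hz
  have h8 : inner ℝ (x + h • u - z) (x - z) ≤ ‖x + h • u - z‖ * ‖x - z‖ := real_inner_le_norm _ _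
  have h9 : inner ℝ (x + h • u - z) (x - z) = ‖x - z‖ ^ 2 + h * inner ℝ u (x - z) := by
    rw [show x + h • u - z = (x - z) + h • u by abel, inner_add_left, real_inner_smul_left,
      real_inner_self_eq_norm_sq]
  rw [hzd, dist_eq_norm]
  have h10 : ‖x - z‖ + c * h < ‖x + h • u - z‖ := by
    have hp : 0 < ‖x - z‖ := hx.trans_le h7
    refine lt_of_mul_lt_mul_right ?_ hp.le
    nlinarith [mul_lt_mul_of_pos_left h6 hh0]
  linarith

open Metric in
lemma npe_max {n : ℕ} (E : Set (EuclideanSpace ℝ (Fin n)))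
    (hE : IsClosed E) (hEne : E.Nonempty) (r : ℝ)
    (huniq : ∀ p : EuclideanSpace ℝ (Fin n),
      0 < infDist p E → infDist p E < r →
      ∃! q : EuclideanSpace ℝ (Fin n), q ∈ E ∧ dist p q = infDist p E)
    (p : EuclideanSpace ℝ (Fin n)) (hp : 0 < infDist p E) (ε : ℝ) (hε : 0 < ε)
    (hr : infDist p E + ε < r) :
    ∃ x, dist x p ≤ ε ∧ infDist p E + ε ≤ infDist x E := by
  have key : ∀ c, 0 ≤ c → c < 1 → ∃ x ∈ closedBall p ε, infDist p E + c * ε ≤ infDist x E := by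
    intro c hc0 hc1
    obtain ⟨x, hx, hmax⟩ := (isCompact_closedBall p ε).exists_isMaxOn
      ⟨p, mem_closedBall_self hε.le⟩
      (f := fun x => infDist x E - c * dist x p)
      (by have := continuous_infDist_pt E; fun_prop)
    have hmax' : ∀ z ∈ closedBall p ε, infDist z E - c * dist z p ≤ infDist x E - c * dist x p :=
      fun z hz => hmax hz
    refine ⟨x, hx, ?_⟩
    have h1 := hmax' p (mem_closedBall_self hε.le)
    rw [dist_self] at h1
    rw [mem_closedBall] at hx
    rcases hx.lt_or_eq with hlt | heq
    · exfalso
      have h2 : infDist x E < r := by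
        have := infDist_le_infDist_add_dist (s := E) (x := x) (y := p)
        linarith
      have h3 : 0 < infDist x E := by
        have := mul_nonneg hc0 (dist_nonneg (x := x) (y := p))
        linarith
      obtain ⟨u, hu, hasc⟩ := npe_ascent E hE hEne x h3 (huniq x h3 h2) c hc1
      obtain ⟨h, hh0, hh1, hh2⟩ := hasc (ε - dist x p) (by linarith)
      have hxx : dist (x + h • u) x = h := by
        simp [dist_eq_norm, norm_smul, hu, abs_of_pos hh0]
      have h4 : dist (x + h • u) p ≤ h + dist x p := by
        have := dist_triangle (x + h • u) x p
        rwa [hxx] at this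
      have h5 := hmax' (x + h • u) (by rw [mem_closedBall]; linarith)
      nlinarith [mul_le_mul_of_nonneg_left h4 hc0]
    · rw [heq] at h1; linarith
  obtain ⟨x, hx, hmax⟩ := (isCompact_closedBall p ε).exists_isMaxOn
      ⟨p, mem_closedBall_self hε.le⟩
      (f := fun x => infDist x E) (continuous_infDist_pt E).continuousOn
  have hmax' : ∀ z ∈ closedBall p ε, infDist z E ≤ infDist x E := fun z hz => hmax hz
  refine ⟨x, hx, ?_⟩
  by_contra! hcon
  have h1 := hmax' p (mem_closedBall_self hε.le)
  obtain ⟨z, hz, hz2⟩ := key (((infDist x E - infDist p E) / ε + 1) / 2)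
    (by have : 0 ≤ (infDist x E - infDist p E) / ε := div_nonneg (by linarith) hε.le
        linarith)
    (by have : (infDist x E - infDist p E) / ε < 1 := by rw [div_lt_one hε]; linarith
        linarith)
  have h2 := hmax' z hz
  have h3 : ((infDist x E - infDist p E) / ε + 1) / 2 * ε
      = (infDist x E - infDist p E + ε) / 2 := by field_simp
  linarith

/-- Extension of the nearest-point relation along normal geodesics within the reach:
if nearest points are unique on the open `r`-tube around a closed set `E` in Euclidean
space and `q + t* • v` has distance `t*` to `E` for some `t* ∈ (0, r)`, then
`q + t • v` has distance `t` to `E` and unique nearest point `q` for every `t ∈ (0, r)`. -/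
theorem nearest_point_extension_along_geodesic
    (n : ℕ) (hn : 1 ≤ n) (E : Set (EuclideanSpace ℝ (Fin n)))
    (hE : IsClosed E) (hEne : E.Nonempty) (r : ℝ) (hr : 0 < r)
    (huniq : ∀ p : EuclideanSpace ℝ (Fin n),
      0 < Metric.infDist p E → Metric.infDist p E < r →
      ∃! q : EuclideanSpace ℝ (Fin n), q ∈ E ∧ dist p q = Metric.infDist p E)
    (q : EuclideanSpace ℝ (Fin n)) (hq : q ∈ E)
    (v : EuclideanSpace ℝ (Fin n)) (hv : ‖v‖ = 1)
    (tstar : ℝ) (htstar : tstar ∈ Set.Ioo 0 r)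
    (hdist : Metric.infDist (q + tstar • v) E = tstar) :
    ∀ t ∈ Set.Ioo (0 : ℝ) r,
      Metric.infDist (q + t • v) E = t ∧
      dist (q + t • v) q = Metric.infDist (q + t • v) E ∧
      ∀ q' ∈ E, dist (q + t • v) q' = Metric.infDist (q + t • v) E → q' = q := by
  have hdq : ∀ t : ℝ, 0 < t → dist (q + t • v) q = t := fun t ht => by
    simp [dist_eq_norm, norm_smul, hv, abs_of_pos ht]
  have main : ∀ t ∈ Set.Ioo (0 : ℝ) r, Metric.infDist (q + t • v) E = t := by
    rintro t ⟨ht0, htr⟩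
    have hle : Metric.infDist (q + t • v) E ≤ t := by
      have := Metric.infDist_le_dist_of_mem (x := q + t • v) hq
      rwa [hdq t ht0] at this
    rcases le_or_gt t tstar with h | h
    · refine le_antisymm hle ?_
      have h1 := Metric.infDist_le_infDist_add_dist (s := E) (x := q + tstar • v) (y := q + t • v)
      have h2 : dist (q + tstar • v) (q + t • v) = tstar - t := by
        rw [dist_add_left, dist_eq_norm, ← sub_smul, norm_smul, hv, mul_one,
          Real.norm_of_nonneg (by linarith)]
      linarith
    · obtain ⟨x, hx, hxd⟩ := npe_max E hE hEne r huniq (q + tstar • v)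
        (by rw [hdist]; exact htstar.1) (t - tstar) (by linarith) (by rw [hdist]; linarith)
      rw [hdist] at hxd
      have h1 := Metric.infDist_le_dist_of_mem (x := x) hq
      have h0 := htstar.1
      have hb : ‖tstar • v‖ = tstar := by rw [norm_smul, hv, mul_one, Real.norm_of_nonneg h0.le]
      set w := x - (q + tstar • v) with hw
      have hwn : ‖w‖ ≤ t - tstar := by rwa [hw, ← dist_eq_norm]
      have hsum : x - q = w + tstar • v := by rw [hw]; abel
      rw [dist_eq_norm, hsum] at h1
      have h2 := norm_add_le w (tstar • v)
      have h3 : ‖w‖ = t - tstar := by linarith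
      have h4 : ‖w + tstar • v‖ = ‖w‖ + ‖tstar • v‖ := by linarith
      rw [norm_add_eq_iff_real, hb, h3, smul_comm] at h4
      have h5 : w = (t - tstar) • v := smul_right_injective _ h0.ne' h4
      have h6 : x = q + t • v := by
        rw [← sub_eq_iff_eq_add', hsum, h5, ← add_smul]; congr 1; ring
      rw [h6] at hxd
      linarith
  intro t ht
  have hm := main t ht
  refine ⟨hm, by rw [hm, hdq t ht.1], fun q' hq' hd => ?_⟩
  exact (huniq (q + t • v) (by rw [hm]; exact ht.1) (by rw [hm]; exact ht.2)).unique
    ⟨hq', hd⟩ ⟨hq, by rw [hm, hdq t ht.1]⟩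
end

section
/- Let n ≥ 1 and let E be a nonempty closed subset of EuclideanSpace ℝ (Fin n). Let r > 0 and assume that every point p with 0 < infDist(p, E) < r has exactly one nearest point in E. Let q be a point of the frontier of E and let v ∈ EuclideanSpace ℝ (Fin n) with ‖v‖ = 1 be such that ⟪v, u⟫ ≤ 0 for every u in the tangent cone of E at q (tangentConeAt ℝ E q). Then for every t ∈ (0, r) one has infDist(q + t·v, E) = t, and q is the unique point of E with dist(q + t·v, q) = infDist(q + t·v, E). -/
open scoped RealInnerProductSpace

/-- stability of the nearest point -/
lemma aux_step {V : Type*} [NormedAddCommGroup V] [InnerProductSpace ℝ V] [ProperSpace V]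
    (E : Set V) (hE : IsClosed E) (hEne : E.Nonempty) (p q : V) (hq : q ∈ E)
    (hpq : dist p q = Metric.infDist p E) (hpos : 0 < Metric.infDist p E)
    (hu : ∀ q' ∈ E, dist p q' = Metric.infDist p E → q' = q)
    (l : ℝ) (hl0 : 0 < l) (hl : l < 1) :
    ∃ e0 > 0, ∀ e, 0 < e → e < e0 →
      Metric.infDist p E + l * e ≤
        Metric.infDist (p + (e / Metric.infDist p E) • (p - q)) E := by
  set d := Metric.infDist p E with hd
  set δ := (1 - l) * d with hδ
  have hδ0 : 0 < δ := mul_pos (by linarith) hpos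
  have hstab : ∃ m > d, ∀ a ∈ E, δ ≤ dist a q → m ≤ dist p a := by
    by_cases hne : (E \ Metric.ball q δ).Nonempty
    · have hcl : IsClosed (E \ Metric.ball q δ) := hE.sdiff Metric.isOpen_ball
      obtain ⟨a, ha, hda⟩ := hcl.exists_infDist_eq_dist hne p
      refine ⟨dist p a, ?_, ?_⟩
      · refine lt_of_le_of_ne (Metric.infDist_le_dist_of_mem ha.1) fun h => ?_
        have := hu a ha.1 h.symm
        apply ha.2
        rw [this]; exact Metric.mem_ball_self hδ0
      · intro b hb hbδ
        rw [← hda]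
        apply Metric.infDist_le_dist_of_mem
        refine ⟨hb, ?_⟩
        simpa using hbδ
    · refine ⟨d + 1, by linarith, fun a ha h => ?_⟩
      exact absurd ⟨a, ha, by simpa using h⟩ hne
  obtain ⟨m, hm, hmE⟩ := hstab
  refine ⟨(m - d) / 2, by linarith, fun e he0 he => ?_⟩
  set w := (e / d) • (p - q) with hw
  have hnpq : ‖p - q‖ = d := by rw [← dist_eq_norm, hpq]
  have hwn : ‖w‖ = e := by
    rw [hw, norm_smul, hnpq, Real.norm_of_nonneg (by positivity)]
    field_simp
  obtain ⟨a, ha, hda⟩ := hE.exists_infDist_eq_dist hEne (p + w)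
  have hpp : dist (p + w) p = e := by simp [dist_eq_norm, hwn]
  have haq : dist a q < δ := by
    by_contra h
    push Not at h
    have h1 := hmE a ha h
    have h2 : Metric.infDist (p + w) E ≤ d + e := by
      have := Metric.infDist_le_infDist_add_dist (s := E) (x := p + w) (y := p)
      rw [hpp] at this; exact this
    have h3 := dist_triangle p (p + w) a
    rw [dist_comm p (p + w), hpp] at h3
    linarith
  rw [hda, dist_eq_norm]
  have hda2 : d ≤ ‖p - a‖ := by
    rw [← dist_eq_norm]; exact Metric.infDist_le_dist_of_mem ha
  have hin : e * (d - δ) ≤ ⟪p - a, w⟫ := by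
    have e1 : p - a = (p - q) + (q - a) := by abel
    have e2 : ⟪p - q, w⟫ = e * d := by
      rw [hw, inner_smul_right, real_inner_self_eq_norm_sq, hnpq]; field_simp
    have e3 : -(δ * e) ≤ ⟪q - a, w⟫ := by
      have h1 := abs_real_inner_le_norm (q - a) w
      have h2 : ‖q - a‖ < δ := by rw [← dist_eq_norm, dist_comm]; exact haq
      rw [hwn] at h1
      have h3 := neg_abs_le (⟪q - a, w⟫ : ℝ)
      nlinarith
    rw [e1, inner_add_left, e2]; linarith
  have e4 : p + w - a = (p - a) + w := by abel
  have e5 : ‖p + w - a‖ ^ 2 = ‖p - a‖ ^ 2 + 2 * ⟪p - a, w⟫ + e ^ 2 := by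
    rw [e4, norm_add_sq_real, hwn]
  have e6 : (d + l * e) ^ 2 ≤ ‖p + w - a‖ ^ 2 := by
    rw [e5]
    have : d ^ 2 ≤ ‖p - a‖ ^ 2 := by gcongr
    have h7 : (l * e) ^ 2 ≤ e ^ 2 := by
      have : l * e ≤ e := by nlinarith
      gcongr
    have h8 : e * (d - δ) = l * e * d := by rw [hδ]; ring
    nlinarith
  exact le_of_pow_le_pow_left₀ two_ne_zero (by positivity) e6

lemma aux_far {V : Type*} [NormedAddCommGroup V] [InnerProductSpace ℝ V] [ProperSpace V]
    (E : Set V) (hE : IsClosed E) (hEne : E.Nonempty) (r : ℝ)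
    (huniq : ∀ p : V, 0 < Metric.infDist p E → Metric.infDist p E < r →
      ∃! q : V, q ∈ E ∧ dist p q = Metric.infDist p E)
    (p0 : V) (hpos : 0 < Metric.infDist p0 E) (b : ℝ) (hb : Metric.infDist p0 E ≤ b)
    (hbr : b < r) :
    ∃ p, Metric.infDist p E = b ∧ dist p p0 ≤ b - Metric.infDist p0 E := by
  have hcont : Continuous fun p : V => Metric.infDist p E := Metric.continuous_infDist_pt E
  set d := Metric.infDist p0 E with hd
  have key : ∀ l : ℝ, 0 < l → l < 1 → ∃ p, Metric.infDist p E = b ∧ l * dist p p0 ≤ b - d := by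
    intro l hl0 hl1
    set K : Set V := {p | d + l * dist p p0 ≤ Metric.infDist p E ∧ Metric.infDist p E ≤ b} with hK
    have hKc : IsClosed K :=
      (isClosed_le (by fun_prop) hcont).inter (isClosed_le hcont continuous_const)
    have hKb : K ⊆ Metric.closedBall p0 ((b - d) / l) := by
      intro p hp
      rw [Metric.mem_closedBall, le_div_iff₀ hl0]
      have := hp.1.trans hp.2
      linarith
    have hKcomp : IsCompact K := (isCompact_closedBall p0 _).of_isClosed_subset hKc hKb
    have hKne : K.Nonempty := ⟨p0, by simp [hK, ← hd, hb]⟩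
    obtain ⟨p, hp, hmax⟩ := hKcomp.exists_isMaxOn hKne hcont.continuousOn
    have hpd : d ≤ Metric.infDist p E := by
      have := hp.1
      have h2 := mul_nonneg hl0.le (dist_nonneg (x := p) (y := p0))
      linarith
    have hpb : Metric.infDist p E = b := by
      by_contra hne
      have hlt : Metric.infDist p E < b := lt_of_le_of_ne hp.2 hne
      have hp0 : 0 < Metric.infDist p E := by linarith
      obtain ⟨q, ⟨hqE, hqd⟩, hqu⟩ := huniq p hp0 (by linarith)
      obtain ⟨e0, he0, hstep⟩ := aux_step E hE hEne p q hqE hqd hp0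
        (fun q' h1 h2 => hqu q' ⟨h1, h2⟩) l hl0 hl1
      set e := min (e0 / 2) (b - Metric.infDist p E) with he
      have hepos : 0 < e := lt_min (by linarith) (by linarith)
      have hee0 : e < e0 := lt_of_le_of_lt (min_le_left _ _) (by linarith)
      have heb : e ≤ b - Metric.infDist p E := min_le_right _ _
      have hs := hstep e hepos hee0
      set p' := p + (e / Metric.infDist p E) • (p - q) with hp'
      have hdp : dist p' p = e := by
        rw [hp', dist_eq_norm, add_sub_cancel_left, norm_smul, ← dist_eq_norm, hqd,
          Real.norm_of_nonneg (by positivity)]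
        field_simp
      have hp'K : p' ∈ K := by
        constructor
        · have h1 := dist_triangle p' p p0
          have h2 := hp.1
          rw [hdp] at h1
          nlinarith
        · have := Metric.infDist_le_infDist_add_dist (s := E) (x := p') (y := p)
          rw [hdp] at this
          linarith
      have h3 : Metric.infDist p' E ≤ Metric.infDist p E := hmax hp'K
      nlinarith [mul_pos hl0 hepos]
    refine ⟨p, hpb, ?_⟩
    have := hp.1
    linarith
  have hSc : IsClosed {p : V | Metric.infDist p E = b} := isClosed_eq hcont continuous_const
  have hSne : {p : V | Metric.infDist p E = b}.Nonempty := by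
    obtain ⟨p, hp, -⟩ := key (1/2) (by norm_num) (by norm_num)
    exact ⟨p, hp⟩
  obtain ⟨p, hp, hpd⟩ := hSc.exists_infDist_eq_dist hSne p0
  refine ⟨p, hp, ?_⟩
  have h1 : ∀ l : ℝ, 0 < l → l < 1 → l * dist p p0 ≤ b - d := by
    intro l hl0 hl1
    obtain ⟨p', hp', hl'⟩ := key l hl0 hl1
    have h2 : dist p0 p ≤ dist p0 p' := by
      rw [← hpd]; exact Metric.infDist_le_dist_of_mem hp'
    rw [dist_comm p0 p, dist_comm p0 p'] at h2
    nlinarith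
  by_contra hcon
  push Not at hcon
  have hD : 0 < dist p p0 := by linarith
  obtain ⟨c, hc1, hc2⟩ := exists_between hcon
  have := h1 (c / dist p p0) (by apply div_pos _ hD; linarith) (by rw [div_lt_one hD]; exact hc2)
  rw [div_mul_cancel₀ _ hD.ne'] at this
  linarith

lemma aux_prox {V : Type*} [NormedAddCommGroup V] [InnerProductSpace ℝ V] [ProperSpace V]
    (E : Set V) (hE : IsClosed E) (hEne : E.Nonempty) (r : ℝ)
    (huniq : ∀ p : V, 0 < Metric.infDist p E → Metric.infDist p E < r →
      ∃! q : V, q ∈ E ∧ dist p q = Metric.infDist p E)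
    (p q : V) (hq : q ∈ E) (hpq : dist p q = Metric.infDist p E)
    (hpos : 0 < Metric.infDist p E) (b : ℝ) (hb : Metric.infDist p E ≤ b)
    (hbr : b < r) (a : V) (ha : a ∈ E) :
    2 * b * ⟪p - q, a - q⟫ ≤ Metric.infDist p E * ‖a - q‖ ^ 2 := by
  obtain ⟨z, hz, hzp⟩ := aux_far E hE hEne r huniq p hpos b hb hbr
  set d := Metric.infDist p E with hd
  have hy : ‖p - q‖ = d := by rw [← dist_eq_norm, hpq]
  have hx : ‖z - p‖ ≤ b - d := by rw [← dist_eq_norm]; exact hzp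
  have hzq : b ≤ ‖z - q‖ := by
    rw [← hz, ← dist_eq_norm]; exact Metric.infDist_le_dist_of_mem hq
  have hza : b ≤ ‖z - a‖ := by
    rw [← hz, ← dist_eq_norm]; exact Metric.infDist_le_dist_of_mem ha
  have hb0 : 0 < b := by linarith
  -- d (z-p) = (b-d) (p-q)
  have hxx : ‖z - p‖ ^ 2 ≤ (b - d) ^ 2 := by gcongr
  have e1 : z - q = (z - p) + (p - q) := by abel
  have e2 : ‖z - q‖ ^ 2 = ‖z - p‖ ^ 2 + 2 * ⟪z - p, p - q⟫ + d ^ 2 := by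
    rw [e1, norm_add_sq_real, hy]
  have e3 : b ^ 2 ≤ ‖z - q‖ ^ 2 := by gcongr
  have e4 : ‖d • (z - p) - (b - d) • (p - q)‖ ^ 2 ≤ 0 := by
    rw [norm_sub_sq_real, norm_smul, norm_smul, inner_smul_left, inner_smul_right, hy, mul_pow,
      mul_pow, Real.norm_eq_abs, Real.norm_eq_abs, sq_abs, sq_abs]
    simp only [conj_trivial]
    have h5 : b ^ 2 - (b - d) ^ 2 - d ^ 2 ≤ 2 * ⟪z - p, p - q⟫ := by linarith
    have h6 := mul_le_mul_of_nonneg_left h5 (mul_nonneg hpos.le (sub_nonneg.2 hb))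
    have h7 := mul_le_mul_of_nonneg_left hxx (sq_nonneg d)
    have h8 : (b-d)* d * (b ^ 2 - (b - d) ^ 2 - d ^ 2) = 2 * (b-d)^2 * d^2 := by ring
    nlinarith
  have e5 : d • (z - p) - (b - d) • (p - q) = 0 := by
    have : ‖d • (z - p) - (b - d) • (p - q)‖ = 0 := by
      apply pow_eq_zero_iff (two_ne_zero) |>.1
      exact le_antisymm e4 (sq_nonneg _)
    exact norm_eq_zero.1 this
  have e6 : d • (z - a) = b • (p - q) - d • (a - q) := by
    have : d • (z - a) = (d • (z - p) - (b - d) • (p - q)) + (b • (p - q) - d • (a - q)) := by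
      module
    rw [this, e5, zero_add]
  have e7 : d ^ 2 * ‖z - a‖ ^ 2 =
      b ^ 2 * d ^ 2 - 2 * (b * (d * ⟪p - q, a - q⟫)) + d ^ 2 * ‖a - q‖ ^ 2 := by
    have : d ^ 2 * ‖z - a‖ ^ 2 = ‖d • (z - a)‖ ^ 2 := by
      rw [norm_smul, mul_pow, Real.norm_eq_abs, sq_abs]
    rw [this, e6, norm_sub_sq_real, norm_smul, norm_smul, inner_smul_left, inner_smul_right, hy,
      mul_pow, mul_pow, Real.norm_eq_abs, Real.norm_eq_abs, sq_abs, sq_abs]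
    simp only [conj_trivial]
  have e8 : b ^ 2 ≤ ‖z - a‖ ^ 2 := by gcongr
  have e9 := mul_le_mul_of_nonneg_left e8 (sq_nonneg d)
  have : d * (2 * b * ⟪p - q, a - q⟫) ≤ d * (d * ‖a - q‖ ^ 2) := by nlinarith
  exact le_of_mul_le_mul_left this hpos

lemma aux_tan {V : Type*} [NormedAddCommGroup V] [InnerProductSpace ℝ V] [ProperSpace V]
    (E : Set V) (q v : V) (hnormal : ∀ u ∈ tangentConeAt ℝ E q, ⟪v, u⟫ ≤ 0)
    (η : ℝ) (hη : 0 < η) :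
    ∃ ρ > 0, ∀ a ∈ E, dist a q < ρ → ⟪v, a - q⟫ ≤ η * ‖a - q‖ := by
  by_contra hcon
  push Not at hcon
  have h1 : ∀ k : ℕ, ∃ a ∈ E, dist a q < 1 / ((k : ℝ) + 1) ∧ η * ‖a - q‖ < ⟪v, a - q⟫ :=
    fun k => hcon _ Nat.one_div_pos_of_nat
  choose a haE had hav using h1
  have hne : ∀ k, 0 < ‖a k - q‖ := by
    intro k
    rw [norm_pos_iff]
    intro h
    have := hav k
    rw [h] at this
    simp at this
  have hs : ∀ k, ‖a k - q‖⁻¹ • (a k - q) ∈ Metric.sphere (0 : V) 1 := by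
    intro k
    rw [mem_sphere_zero_iff_norm, norm_smul, norm_inv, norm_norm, inv_mul_cancel₀ (hne k).ne']
  obtain ⟨u, -, φ, hφ, hu⟩ := (isCompact_sphere (0 : V) 1).tendsto_subseq hs
  have hut : u ∈ tangentConeAt ℝ E q := by
    refine mem_tangentConeAt_of_seq Filter.atTop (fun k => ‖a (φ k) - q‖⁻¹)
      (fun k => a (φ k) - q) ?_ ?_ hu
    · have : Filter.Tendsto (fun k => a k - q) Filter.atTop (nhds 0) := by
        refine squeeze_zero_norm (fun k => ?_) tendsto_one_div_add_atTop_nhds_zero_nat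
        rw [← dist_eq_norm]; exact (had k).le
      exact this.comp hφ.tendsto_atTop
    · exact Filter.Eventually.of_forall fun k => by simpa using haE (φ k)
  have h2 : η ≤ ⟪v, u⟫ := by
    refine ge_of_tendsto (Filter.Tendsto.inner tendsto_const_nhds hu)
      (Filter.Eventually.of_forall fun k => ?_)
    simp only [Function.comp]
    rw [inner_smul_right, inv_mul_eq_div, le_div_iff₀ (hne _)]
    exact (hav _).le
  linarith [hnormal u hut]

lemma aux_main {V : Type*} [NormedAddCommGroup V] [InnerProductSpace ℝ V] [ProperSpace V]
    (E : Set V) (hE : IsClosed E) (hEne : E.Nonempty) (r : ℝ)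
    (huniq : ∀ p : V, 0 < Metric.infDist p E → Metric.infDist p E < r →
      ∃! q : V, q ∈ E ∧ dist p q = Metric.infDist p E)
    (q v : V) (hq : q ∈ E) (hv : ‖v‖ = 1)
    (hnormal : ∀ u ∈ tangentConeAt ℝ E q, ⟪v, u⟫ ≤ 0)
    (b : ℝ) (hb : 0 < b) (hbr : b < r) (a : V) (ha : a ∈ E) :
    2 * b * ⟪v, a - q⟫ ≤ ‖a - q‖ ^ 2 := by
  have h1 : ∀ k : ℕ, ∃ f e : V, ‖f‖ ≤ 1 / ((k : ℝ) + 1) ∧ ‖e‖ ≤ 1 / ((k : ℝ) + 1) ∧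
      2 * b * ⟪v + e, a - q + f⟫ ≤ ‖a - q + f‖ ^ 2 := by
    intro k
    set κ : ℝ := 1 / ((k : ℝ) + 1) with hκ
    have hκ0 : 0 < κ := Nat.one_div_pos_of_nat
    have hκ1 : κ ≤ 1 := by
      rw [hκ, div_le_one (by positivity)]; linarith [(Nat.cast_nonneg k : (0 : ℝ) ≤ k)]
    obtain ⟨ρ, hρ, hT⟩ := aux_tan E q v hnormal (κ / 4) (by positivity)
    obtain ⟨s, hs0, hs⟩ : ∃ s, 0 < s ∧ s < min (ρ / 2) (min b 1) :=
      exists_between (lt_min (by positivity) (lt_min hb one_pos))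
    simp only [lt_min_iff] at hs
    obtain ⟨hs1, hs2, hs3⟩ := hs
    obtain ⟨Q, hQ, hdQ⟩ := hE.exists_infDist_eq_dist hEne (q + s • v)
    have hds : Metric.infDist (q + s • v) E ≤ s := by
      have := Metric.infDist_le_dist_of_mem (x := q + s • v) hq
      rwa [dist_eq_norm, add_sub_cancel_left, norm_smul, hv, mul_one,
        Real.norm_of_nonneg hs0.le] at this
    have hn : ‖s • v - (Q - q)‖ ≤ s := by
      rw [hdQ, dist_eq_norm] at hds
      have e0 : s • v - (Q - q) = q + s • v - Q := by abel
      rw [e0]; exact hds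
    have hsv : ‖s • v‖ = s := by rw [norm_smul, hv, mul_one, Real.norm_of_nonneg hs0.le]
    have hQ2 : ‖Q - q‖ ≤ 2 * s := by
      have := norm_sub_le (s • v) (s • v - (Q - q))
      rw [sub_sub_cancel] at this
      linarith
    have hT1 := hT Q hQ (by rw [dist_eq_norm]; linarith)
    have hsq : ‖s • v - (Q - q)‖ ^ 2 ≤ s ^ 2 := by gcongr
    rw [norm_sub_sq_real, hsv, inner_smul_left] at hsq
    simp only [conj_trivial] at hsq
    have hQs : ‖Q - q‖ ≤ κ / 2 * s := by
      rcases (norm_nonneg (Q - q)).eq_or_lt with h | h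
      · rw [← h]; positivity
      · have h3 := mul_le_mul_of_nonneg_left hT1 hs0.le
        have : ‖Q - q‖ * ‖Q - q‖ ≤ ‖Q - q‖ * (κ / 2 * s) := by nlinarith
        exact le_of_mul_le_mul_left this h
    have hQs2 : ‖Q - q‖ ≤ κ * s := by nlinarith
    have hdpos : 0 < Metric.infDist (q + s • v) E := by
      rw [hdQ, dist_eq_norm]
      have e1 : q + s • v - Q = s • v - (Q - q) := by abel
      rw [e1]
      have := norm_sub_norm_le (s • v) (Q - q)
      nlinarith
    have hp := aux_prox E hE hEne r huniq (q + s • v) Q hQ hdQ.symm hdpos b (by linarith) hbr a ha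
    refine ⟨q - Q, s⁻¹ • (q - Q), ?_, ?_, ?_⟩
    · rw [norm_sub_rev]; nlinarith
    · rw [norm_smul, norm_sub_rev, norm_inv, Real.norm_of_nonneg hs0.le, inv_mul_eq_div,
        div_le_iff₀ hs0]
      exact hQs2
    · have e1 : a - q + (q - Q) = a - Q := by abel
      have e2 : q + s • v - Q = s • (v + s⁻¹ • (q - Q)) := by
        rw [smul_add, smul_inv_smul₀ hs0.ne']; abel
      rw [e1]
      rw [e2, inner_smul_left] at hp
      simp only [conj_trivial] at hp
      have h4 := mul_le_mul_of_nonneg_right hds (sq_nonneg ‖a - Q‖)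
      refine le_of_mul_le_mul_left ?_ hs0
      linarith
  choose f e hf he h using h1
  have hf0 := squeeze_zero_norm hf tendsto_one_div_add_atTop_nhds_zero_nat
  have he0 := squeeze_zero_norm he tendsto_one_div_add_atTop_nhds_zero_nat
  have hA : Filter.Tendsto (fun k => a - q + f k) Filter.atTop (nhds (a - q)) := by
    simpa using (tendsto_const_nhds (x := a - q)).add hf0
  have hB : Filter.Tendsto (fun k => v + e k) Filter.atTop (nhds v) := by
    simpa using (tendsto_const_nhds (x := v)).add he0
  exact le_of_tendsto_of_tendsto' ((hB.inner hA).const_mul (2 * b)) (hA.norm.pow 2) h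



/-- From a boundary point of a set with positive reach in Euclidean space, every unit
direction in the normal cone yields points whose unique nearest point is that boundary
point, with distance to the set equal to the parameter. -/
theorem normal_cone_direction_nearest_point
    (n : ℕ) (hn : 1 ≤ n) (E : Set (EuclideanSpace ℝ (Fin n)))
    (hE : IsClosed E) (hEne : E.Nonempty) (r : ℝ) (hr : 0 < r)
    (huniq : ∀ p : EuclideanSpace ℝ (Fin n),
      0 < Metric.infDist p E → Metric.infDist p E < r →
      ∃! q : EuclideanSpace ℝ (Fin n), q ∈ E ∧ dist p q = Metric.infDist p E)
    (q : EuclideanSpace ℝ (Fin n)) (hq : q ∈ frontier E)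
    (v : EuclideanSpace ℝ (Fin n)) (hv : ‖v‖ = 1)
    (hnormal : ∀ u ∈ tangentConeAt ℝ E q, ⟪v, u⟫ ≤ 0) :
    ∀ t ∈ Set.Ioo (0 : ℝ) r,
      Metric.infDist (q + t • v) E = t ∧
      dist (q + t • v) q = Metric.infDist (q + t • v) E ∧
      ∀ q' ∈ E, dist (q + t • v) q' = Metric.infDist (q + t • v) E → q' = q := by

  intro t ht
  obtain ⟨ht0, htr⟩ := ht
  have hqE : q ∈ E := hE.frontier_subset hq
  obtain ⟨b, htb, hbr⟩ := exists_between htr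
  have hb : 0 < b := ht0.trans htb
  have key : ∀ a ∈ E, t ^ 2 + (1 - t / b) * ‖a - q‖ ^ 2 ≤ dist (q + t • v) a ^ 2 := by
    intro a ha
    have h1 := aux_main E hE hEne r huniq q v hqE hv hnormal b hb hbr a ha
    have e1 : q + t • v - a = t • v - (a - q) := by abel
    rw [dist_eq_norm, e1, norm_sub_sq_real (t • v) (a - q), norm_smul, hv, inner_smul_left, mul_one,
      Real.norm_of_nonneg ht0.le]
    simp only [conj_trivial]
    have h2 := mul_le_mul_of_nonneg_left h1 (div_pos ht0 hb).le
    have h3 : t / b * (2 * b * ⟪v, a - q⟫) = 2 * (t * ⟪v, a - q⟫) := by field_simp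
    linarith
  have hc : 0 < 1 - t / b := by rw [sub_pos, div_lt_one hb]; exact htb
  have hdq : dist (q + t • v) q = t := by
    rw [dist_eq_norm, add_sub_cancel_left, norm_smul, hv, mul_one, Real.norm_of_nonneg ht0.le]
  have hinf : Metric.infDist (q + t • v) E = t := by
    apply le_antisymm
    · exact (Metric.infDist_le_dist_of_mem hqE).trans_eq hdq
    · rw [Metric.le_infDist hEne]
      intro a ha
      refine le_of_pow_le_pow_left₀ two_ne_zero (by positivity) ?_
      have := key a ha
      have := mul_nonneg hc.le (sq_nonneg ‖a - q‖)
      linarith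
  refine ⟨hinf, by rw [hdq, hinf], fun a ha hda => ?_⟩
  have h1 := key a ha
  rw [hda, hinf] at h1
  have h2 : ‖a - q‖ ^ 2 ≤ 0 := by
    by_contra h
    push Not at h
    have := mul_pos hc h
    linarith
  have h3 : ‖a - q‖ = 0 := (pow_eq_zero_iff two_ne_zero).1 (le_antisymm h2 (sq_nonneg _))
  exact sub_eq_zero.1 (norm_eq_zero.1 h3)
end

section
/- Let H be a real inner product space, Σ ⊆ H a nonempty set, ε > 0, and let C be a convex subset of {x ∈ H : infDist(x, Σ) ≥ ε}. Then the function x ↦ infDist(x, Σ) − ‖x‖² / (2ε) is concave on C. -/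
theorem aux_norm_identity {H : Type*} [NormedAddCommGroup H] [InnerProductSpace ℝ H]
    (u v : H) (a b : ℝ) (hab : a + b = 1) :
    ‖a • u + b • v‖ ^ 2 = a * ‖u‖ ^ 2 + b * ‖v‖ ^ 2 - a * b * ‖u - v‖ ^ 2 := by
  rw [norm_add_sq_real, norm_sub_sq_real, norm_smul, norm_smul, mul_pow, mul_pow,
    real_inner_smul_left, real_inner_smul_right, Real.norm_eq_abs, Real.norm_eq_abs,
    sq_abs, sq_abs]
  obtain rfl : b = 1 - a := by linarith
  ring

/-- Away from a set `Σ`, the distance function to `Σ` becomes concave after subtracting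
the fixed multiple `‖x‖² / (2ε)` of the squared norm, on any convex set at distance at
least `ε` from `Σ`. -/
theorem infDist_semiconcave (H : Type*) [NormedAddCommGroup H] [InnerProductSpace ℝ H]
    (S : Set H) (hSne : S.Nonempty) (ε : ℝ) (hε : 0 < ε)
    (C : Set H) (hC : Convex ℝ C) (hCS : C ⊆ {x : H | ε ≤ Metric.infDist x S}) :
    ConcaveOn ℝ C (fun x => Metric.infDist x S - ‖x‖ ^ 2 / (2 * ε)) := by
  refine ⟨hC, fun x hx y hy a b ha hb hab => ?_⟩
  have hz : ε ≤ Metric.infDist (a • x + b • y) S := hCS (hC hx hy ha hb hab)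
  have key : a * Metric.infDist x S + b * Metric.infDist y S
      - a * b * ‖x - y‖ ^ 2 / (2 * ε) ≤ Metric.infDist (a • x + b • y) S := by
    refine (Metric.le_infDist hSne).2 fun p hp => ?_
    have h1 : a * Metric.infDist x S ≤ a * ‖x - p‖ := by
      rw [← dist_eq_norm]
      exact mul_le_mul_of_nonneg_left (Metric.infDist_le_dist_of_mem hp) ha
    have h2 : b * Metric.infDist y S ≤ b * ‖y - p‖ := by
      rw [← dist_eq_norm]
      exact mul_le_mul_of_nonneg_left (Metric.infDist_le_dist_of_mem hp) hb
    have hw : a • x + b • y - p = a • (x - p) + b • (y - p) := by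
      have : p = a • p + b • p := by rw [← add_smul, hab, one_smul]
      rw [smul_sub, smul_sub]
      nth_rewrite 1 [this]
      abel
    have h3 := hz.trans (Metric.infDist_le_dist_of_mem hp)
    rw [dist_eq_norm, hw] at h3 ⊢
    have h4 := aux_norm_identity (x - p) (y - p) a b hab
    rw [sub_sub_sub_cancel_right] at h4
    have h5 : ‖a • (x - p) + b • (y - p)‖ ≤ a * ‖x - p‖ + b * ‖y - p‖ := by
      refine (norm_add_le _ _).trans (le_of_eq ?_)
      rw [norm_smul, norm_smul, Real.norm_of_nonneg ha, Real.norm_of_nonneg hb]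
    generalize ‖a • (x - p) + b • (y - p)‖ = w at *
    generalize ‖x - p‖ = u at *
    generalize ‖y - p‖ = v at *
    generalize ‖x - y‖ = D at *
    have h6 : (a * u + b * v) ^ 2 ≤ w ^ 2 + a * b * D ^ 2 := by
      have h7 : a * u ^ 2 + b * v ^ 2 = (a * u + b * v) ^ 2 + a * b * (u - v) ^ 2 := by
        obtain rfl : b = 1 - a := by linarith
        ring
      have : 0 ≤ a * b * (u - v) ^ 2 := by positivity
      linarith
    have h8 : a * u + b * v - w ≤ a * b * D ^ 2 / (2 * ε) := by
      rw [le_div_iff₀ (by positivity)]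
      nlinarith [mul_nonneg (sub_nonneg.2 h5)
        (show 0 ≤ a * u + b * v + w - 2 * ε by linarith)]
    linarith
  have hid := aux_norm_identity x y a b hab
  simp only [smul_eq_mul]
  rw [hid]
  have : (a * ‖x‖ ^ 2 + b * ‖y‖ ^ 2 - a * b * ‖x - y‖ ^ 2) / (2 * ε)
    = a * (‖x‖ ^ 2 / (2 * ε)) + b * (‖y‖ ^ 2 / (2 * ε)) - a * b * ‖x - y‖ ^ 2 / (2 * ε) := by
    ring
  rw [this]
  linarith
end

section
/- Let n ≥ 3 and define v : EuclideanSpace ℝ (Fin n) → ℝ by v(x) = (‖x‖ · log ‖x‖) ^ (−(n−2)/2), using the real power and the natural logarithm. Then for every x with ‖x‖ > 1, writing r = ‖x‖, the Laplacian of v satisfies Δv(x) = −((n−2)/2) · (r · log r) ^ (−(n+2)/2) · ( ((n−2)/2) · (log r)² − n/2 ). -/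
open scoped RealInnerProductSpace

/-- The Laplacian of a function on a real inner product space: the trace of the second
derivative, computed in an orthonormal basis. -/
noncomputable def laplacian {H : Type*} [NormedAddCommGroup H] [InnerProductSpace ℝ H]
    [FiniteDimensional ℝ H] (f : H → ℝ) (x : H) : ℝ :=
  ∑ i, iteratedFDeriv ℝ 2 f x
    ![stdOrthonormalBasis ℝ H i, stdOrthonormalBasis ℝ H i]

theorem hasFDerivAt_norm_aux {E : Type*} [NormedAddCommGroup E] [InnerProductSpace ℝ E]
    (x : E) (hx : 0 < ‖x‖) :
    HasFDerivAt (fun y : E => ‖y‖) (‖x‖⁻¹ • innerSL ℝ x) x := by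
  have h1 : HasFDerivAt (fun y : E => ‖y‖ ^ 2) (2 • innerSL ℝ x) x :=
    (hasStrictFDerivAt_norm_sq x).hasFDerivAt
  have h2 := h1.sqrt (by positivity)
  have h3 : (fun y : E => √(‖y‖ ^ 2)) = fun y => ‖y‖ := by
    funext y
    exact Real.sqrt_sq (norm_nonneg y)
  rw [h3, Real.sqrt_sq hx.le] at h2
  convert h2 using 1
  ext v
  simp
  field_simp

theorem laplacian_radial_aux {n : ℕ} (f f1 : ℝ → ℝ) (p : ℝ)
    (x : EuclideanSpace ℝ (Fin n)) (hx : 1 < ‖x‖)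
    (hf : ∀ r, 1 < r → HasDerivAt f (f1 r * r) r)
    (hf1 : HasDerivAt f1 p ‖x‖) :
    laplacian (fun y : EuclideanSpace ℝ (Fin n) => f ‖y‖) x = p * ‖x‖ + n * f1 ‖x‖ := by
  have hx0 : 0 < ‖x‖ := by linarith
  have hev : (fderiv ℝ (fun y : EuclideanSpace ℝ (Fin n) => f ‖y‖)) =ᶠ[nhds x]
      fun y => f1 ‖y‖ • innerSL ℝ y := by
    filter_upwards [(isOpen_lt continuous_const continuous_norm).mem_nhds hx] with y hy
    have hy1 : 1 < ‖y‖ := hy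
    have hy0 : 0 < ‖y‖ := by linarith
    have := (hf ‖y‖ hy1).comp_hasFDerivAt y (hasFDerivAt_norm_aux y hy0)
    have h2 := this.fderiv
    simp only [Function.comp_def] at h2
    rw [h2, smul_smul]
    congr 1
    field_simp
  have hd : HasFDerivAt (fun y : EuclideanSpace ℝ (Fin n) => f1 ‖y‖ • innerSL ℝ y) _ x :=
    (hf1.comp_hasFDerivAt x (hasFDerivAt_norm_aux x hx0)).smul
      (innerSL ℝ (E := EuclideanSpace ℝ (Fin n))).hasFDerivAt
  have key : ∀ e : EuclideanSpace ℝ (Fin n), ‖e‖ = 1 →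
      iteratedFDeriv ℝ 2 (fun y : EuclideanSpace ℝ (Fin n) => f ‖y‖) x ![e, e]
        = p * ‖x‖⁻¹ * (inner ℝ x e) ^ 2 + f1 ‖x‖ := by
    intro e he
    rw [iteratedFDeriv_two_apply, hev.fderiv_eq, hd.fderiv]
    have hee : (innerSL ℝ e) e = (1 : ℝ) := by
      rw [innerSL_apply_apply, real_inner_self_eq_norm_sq, he, one_pow]
    simp [hee]
    ring
  unfold laplacian
  rw [Finset.sum_congr rfl fun i _ => key _ ((stdOrthonormalBasis ℝ _).norm_eq_one i)]
  rw [Finset.sum_add_distrib, ← Finset.mul_sum]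
  have hs := (stdOrthonormalBasis ℝ (EuclideanSpace ℝ (Fin n))).sum_sq_inner_left x
  have hs' : ∑ i, (inner ℝ x (stdOrthonormalBasis ℝ (EuclideanSpace ℝ (Fin n)) i)) ^ 2
      = ‖x‖ ^ 2 := by
    rw [← hs]
  rw [hs']
  simp
  field_simp

/-- Explicit Laplacian of the radial function `v = (r log r) ^ (-(n-2)/2)` for `r > 1`. -/
theorem laplacian_radial_log_power (n : ℕ) (hn : 3 ≤ n) :
    ∀ x : EuclideanSpace ℝ (Fin n), 1 < ‖x‖ →
      laplacian (fun y : EuclideanSpace ℝ (Fin n) =>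
          (‖y‖ * Real.log ‖y‖) ^ (-((n : ℝ) - 2) / 2)) x =
        -(((n : ℝ) - 2) / 2) * (‖x‖ * Real.log ‖x‖) ^ (-((n : ℝ) + 2) / 2) *
          (((n : ℝ) - 2) / 2 * (Real.log ‖x‖) ^ 2 - (n : ℝ) / 2) := by
  intro x hx
  set a : ℝ := ((n : ℝ) - 2) / 2 with ha
  have hn' : (n : ℝ) = 2 * a + 2 := by rw [ha]; ring
  have e1 : -((n : ℝ) - 2) / 2 = -a := by rw [ha]; ring
  have e2 : -((n : ℝ) + 2) / 2 = -a - 1 - 1 := by rw [ha]; ring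
  rw [e1, e2]
  have hg : ∀ r : ℝ, 1 < r → HasDerivAt (fun r => r * Real.log r) (Real.log r + 1) r := by
    intro r hr
    exact Real.hasDerivAt_mul_log (by linarith)
  have hpos : ∀ r : ℝ, 1 < r → 0 < r * Real.log r := fun r hr =>
    mul_pos (by linarith) (Real.log_pos hr)
  have hr0 : ‖x‖ ≠ 0 := by positivity
  have hL := (Real.log_pos hx)
  have hf1 := (((hg _ hx).rpow_const (p := -a - 1) (Or.inl (hpos _ hx).ne')).mul
    (((Real.hasDerivAt_log hr0).add_const 1).div (hasDerivAt_id ‖x‖) hr0)).const_mul (-a)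
  have := laplacian_radial_aux (n := n) (fun r => (r * Real.log r) ^ (-a))
    (fun r => -a * ((r * Real.log r) ^ (-a - 1) * ((Real.log r + 1) / r))) _ x hx ?_ hf1
  · rw [this, hn']
    have e3 : (‖x‖ * Real.log ‖x‖) ^ (-a - 1) =
        (‖x‖ * Real.log ‖x‖) ^ (-a - 1 - 1) * (‖x‖ * Real.log ‖x‖) := by
      rw [Real.rpow_sub_one (hpos _ hx).ne' (-a - 1)]
      field_simp
    simp only [e3, id, Pi.div_apply]
    generalize (‖x‖ * Real.log ‖x‖) ^ (-a - 1 - 1) = P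
    generalize Real.log ‖x‖ = L at *
    field_simp
    ring
  · intro r hr
    have hr' : r ≠ 0 := by linarith
    convert (hg _ hr).rpow_const (p := -a) (Or.inl (hpos _ hr).ne') using 1
    field_simp
end

section
/- Let n ≥ 3 and define v : EuclideanSpace ℝ (Fin n) → ℝ by v(x) = (‖x‖ · log ‖x‖) ^ (−(n−2)/2), using the real power and the natural logarithm. Then there exists r₀ > 1 such that Δv(x) < 0 for every x with ‖x‖ ≥ r₀. -/
theorem radial_second {n : ℕ} (f : EuclideanSpace ℝ (Fin n) → ℝ) (G G1 : ℝ → ℝ) (G2 : ℝ)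
    (hf : ∀ y : EuclideanSpace ℝ (Fin n), 1 < ‖y‖ → f y = G (‖y‖ ^ 2))
    (hG : ∀ s : ℝ, 1 < s → HasDerivAt G (G1 s) s)
    (x : EuclideanSpace ℝ (Fin n)) (hx : 1 < ‖x‖)
    (hG1 : HasDerivAt G1 G2 (‖x‖ ^ 2)) :
    laplacian f x = 4 * ‖x‖ ^ 2 * G2 + 2 * n * G1 (‖x‖ ^ 2) := by
  have hopen : IsOpen {y : EuclideanSpace ℝ (Fin n) | 1 < ‖y‖} :=
    isOpen_lt continuous_const continuous_norm
  have hev : fderiv ℝ f =ᶠ[nhds x]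
      fun y => G1 (‖y‖ ^ 2) • ((2 : ℝ) • innerSL ℝ y) := by
    filter_upwards [hopen.mem_nhds hx] with y hy
    have hy1 : (1 : ℝ) < ‖y‖ := hy
    have h1 : HasFDerivAt (fun z : EuclideanSpace ℝ (Fin n) => ‖z‖ ^ 2)
        ((2 : ℝ) • innerSL ℝ y) y := by
      rw [ofNat_smul_eq_nsmul ℝ 2]
      exact (hasStrictFDerivAt_norm_sq y).hasFDerivAt
    have h2 := (hG (‖y‖ ^ 2) (by nlinarith)).comp_hasFDerivAt y h1
    have h3 : f =ᶠ[nhds y] (G ∘ fun z : EuclideanSpace ℝ (Fin n) => ‖z‖ ^ 2) := by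
      filter_upwards [hopen.mem_nhds hy] with z hz
      exact hf z hz
    exact (h2.congr_of_eventuallyEq h3).fderiv
  have hx1 : HasFDerivAt (fun z : EuclideanSpace ℝ (Fin n) => ‖z‖ ^ 2)
        ((2 : ℝ) • innerSL ℝ x) x := by
    rw [ofNat_smul_eq_nsmul ℝ 2]
    exact (hasStrictFDerivAt_norm_sq x).hasFDerivAt
  have hx2 := hG1.comp_hasFDerivAt x hx1
  have hL : HasFDerivAt (fun y : EuclideanSpace ℝ (Fin n) => (2 : ℝ) • innerSL ℝ y)
      ((2 : ℝ) • (innerSL ℝ : EuclideanSpace ℝ (Fin n) →L[ℝ] _)) x :=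
    ((innerSL ℝ : EuclideanSpace ℝ (Fin n) →L[ℝ] _).hasFDerivAt (x := x)).const_smul (2 : ℝ)
  have hx3 := (hx2.smul hL).congr_of_eventuallyEq hev
  have key : ∀ e : EuclideanSpace ℝ (Fin n), iteratedFDeriv ℝ 2 f x ![e, e] =
      4 * G2 * (inner ℝ e x * inner ℝ x e) + 2 * G1 (‖x‖ ^ 2) * ‖e‖ ^ 2 := by
    intro e
    rw [iteratedFDeriv_two_apply, hx3.fderiv]
    have hee : (innerSL ℝ e) e = ‖e‖ ^ 2 := real_inner_self_eq_norm_sq e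
    simp [real_inner_comm x e, hee]
    ring
  unfold laplacian
  simp only [key]
  rw [Finset.sum_add_distrib, ← Finset.mul_sum]
  have h4 := (stdOrthonormalBasis ℝ (EuclideanSpace ℝ (Fin n))).sum_inner_mul_inner x x
  have h5 : ∑ i, inner ℝ ((stdOrthonormalBasis ℝ (EuclideanSpace ℝ (Fin n))) i) x *
      inner ℝ x ((stdOrthonormalBasis ℝ (EuclideanSpace ℝ (Fin n))) i) = ‖x‖ ^ 2 := by
    rw [← real_inner_self_eq_norm_sq, ← h4]
    exact Finset.sum_congr rfl fun i _ => mul_comm _ _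
  rw [h5]
  simp
  ring

theorem radial_log_power_superharmonic_far_out (n : ℕ) (hn : 3 ≤ n) :
    ∃ r₀ : ℝ, 1 < r₀ ∧
      ∀ x : EuclideanSpace ℝ (Fin n), r₀ ≤ ‖x‖ →
        laplacian (fun y : EuclideanSpace ℝ (Fin n) =>
            (‖y‖ * Real.log ‖y‖) ^ (-((n : ℝ) - 2) / 2)) x < 0 := by
  refine ⟨Real.exp 2, by simp, fun x hx => ?_⟩
  have hn' : (3 : ℝ) ≤ n := by exact_mod_cast hn
  obtain ⟨a, ha⟩ : ∃ a : ℝ, a = ((n : ℝ) - 2) / 2 := ⟨_, rfl⟩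
  have ha2 : 1 / 2 ≤ a := by linarith
  have hna : (n : ℝ) = 2 * a + 2 := by linarith
  have hx1 : 1 < ‖x‖ := lt_of_lt_of_le (by simp) hx
  have ht : 2 ≤ Real.log ‖x‖ := by
    rw [Real.le_log_iff_exp_le (by linarith)]; exact hx
  let T : ℝ → ℝ := fun s => Real.log s / 2
  let G : ℝ → ℝ := fun s => Real.exp (-a * (T s + Real.log (T s)))
  let Q : ℝ → ℝ := fun s => (-a) * (1 + (T s)⁻¹) * (2 * s)⁻¹
  have hTpos : ∀ s : ℝ, 1 < s → 0 < T s := fun s hs => half_pos (Real.log_pos hs)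
  have hT : ∀ s : ℝ, 1 < s → HasDerivAt T ((2 * s)⁻¹) s := by
    intro s hs
    have := (Real.hasDerivAt_log (by linarith : s ≠ 0)).div_const 2
    refine this.congr_deriv ?_
    have : s ≠ 0 := by linarith
    field_simp
  have hG : ∀ s : ℝ, 1 < s → HasDerivAt G (G s * Q s) s := by
    intro s hs
    have h0 := hTpos s hs
    have := (((hT s hs).add ((hT s hs).log h0.ne')).const_mul (-a)).exp
    refine HasDerivAt.congr_deriv (f := G) this ?_
    have hs0 : s ≠ 0 := by linarith
    have h0' := h0.ne'
    change Real.exp (-a * (T s + Real.log (T s))) * _ =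
      Real.exp (-a * (T s + Real.log (T s))) * ((-a) * (1 + (T s)⁻¹) * (2 * s)⁻¹)
    field_simp
  have hsx : 1 < ‖x‖ ^ 2 := by nlinarith
  have hTx : T (‖x‖ ^ 2) = Real.log ‖x‖ := by
    simp only [T, Real.log_pow]; push_cast; ring
  have hs0 : ‖x‖ ^ 2 ≠ 0 := by positivity
  have hQ := (((hT _ hsx).inv (hTpos _ hsx).ne').const_add 1 |>.const_mul (-a)).mul
    (((hasDerivAt_id (‖x‖ ^ 2)).const_mul 2).inv (by simpa using hs0))
  have hG1 := (hG _ hsx).mul hQ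
  have hlap := radial_second (fun y : EuclideanSpace ℝ (Fin n) =>
            (‖y‖ * Real.log ‖y‖) ^ (-((n : ℝ) - 2) / 2)) G (fun s => G s * Q s) _ ?_ hG x hx1 hG1
  · rw [hlap, hna]
    have hGp : 0 < G (‖x‖ ^ 2) := Real.exp_pos _
    simp only [Q, id, Pi.inv_apply, Pi.mul_apply, hTx]
    generalize G (‖x‖ ^ 2) = g at *
    generalize Real.log ‖x‖ = t at *
    generalize ‖x‖ ^ 2 = s at *
    have hneg : (a ^ 2 + a) - a ^ 2 * t ^ 2 < 0 := by
      nlinarith [mul_nonneg (sq_nonneg a) (by nlinarith : 0 ≤ t ^ 2 - 4)]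
    have hfin : g / (s * t ^ 2) * ((a ^ 2 + a) - a ^ 2 * t ^ 2) < 0 :=
      mul_neg_of_pos_of_neg (by positivity) hneg
    refine lt_of_eq_of_lt ?_ hfin
    have : t ≠ 0 := by linarith
    simp
    field_simp
    ring
  · intro y hy
    have hl := Real.log_pos hy
    have hy0 : 0 < ‖y‖ := by linarith
    simp only [G, T, Real.log_pow]
    rw [Real.rpow_def_of_pos (by positivity), Real.log_mul hy0.ne' hl.ne', hna]
    congr 1
    push_cast
    rw [show 2 * Real.log ‖y‖ / 2 = Real.log ‖y‖ by ring]
    ring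
end
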